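/- arXiv:2004.09129 — 7 statements merged into one kernel-verified Lean document; each statement's English description precedes it below -/
import Mathlib

section
/- For distinct tree edges e, e' of T, CutSet(e, e') equals the symmetric difference CovSet(e) △ CovSet(e'); consequently Cut(e, e') = Cov(e) + Cov(e') − 2·Cov(e, e'). -/
open SimpleGraph

variable {V : Type}

/-- An edge `x` covers a tree edge `e` if `e` lies on the (unique) `T`-path
between the endpoints of `x`. -/
def Covers (T : SimpleGraph V) (x e : Sym2 V) : Prop :=
  ∀ u u' : V, x = s(u, u') → ∀ p : T.Path u u', e ∈ p.1.edges

/-- The edge `x` crosses the bipartition `(S, Sᶜ)`. -/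
def Crosses (S : Set V) (x : Sym2 V) : Prop :=
  ∃ a b : V, x = s(a, b) ∧ a ∈ S ∧ b ∉ S

/-- Total weight of a set of edges. -/
noncomputable def setW (w : Sym2 V → ℕ) (S : Set (Sym2 V)) : ℕ :=
  ∑ᶠ x ∈ S, w x

/-- The set of edges of `G` covering the tree edge `e`. -/
def covSet (G T : SimpleGraph V) (e : Sym2 V) : Set (Sym2 V) :=
  {x ∈ G.edgeSet | Covers T x e}

theorem crosses_mk_iff (S : Set V) (a b : V) :
    Crosses S s(a, b) ↔ ¬(a ∈ S ↔ b ∈ S) := by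
  constructor
  · rintro ⟨c, d, h, hc, hd⟩
    rcases Sym2.eq_iff.mp h with ⟨rfl, rfl⟩ | ⟨rfl, rfl⟩ <;> tauto
  · intro h
    by_cases ha : a ∈ S
    · exact ⟨a, b, rfl, ha, fun hb => h (by tauto)⟩
    · exact ⟨b, a, Sym2.eq_swap, by tauto, ha⟩

/-- In a tree, covering can be tested on any single path between the endpoints. -/
theorem covers_mk_iff {T : SimpleGraph V} (hT : T.IsAcyclic) {a b : V} (p : T.Path a b)
    (e : Sym2 V) : Covers T s(a, b) e ↔ e ∈ p.1.edges := by
  refine ⟨fun h => h a b rfl p, fun h u u' hu q => ?_⟩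
  rcases Sym2.eq_iff.mp hu with ⟨rfl, rfl⟩ | ⟨rfl, rfl⟩
  · rwa [(hT.subsingleton_path _ _).elim q p]
  · rw [(hT.subsingleton_path _ _).elim q p.reverse]
    simpa using h

/-- If `e` and `e'` are the only edges of `T` crossing `S`, then a trail joins two vertices on
different sides of `S` iff it uses exactly one of `e` and `e'`. -/
theorem SimpleGraph.Walk.IsTrail.mem_iff_mem_iff {T : SimpleGraph V} {e e' : Sym2 V}
    (hne : e ≠ e') {S : Set V} (hS : ∀ f ∈ T.edgeSet, Crosses S f ↔ f = e ∨ f = e') {u v : V}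
    {p : T.Walk u v} (hp : p.IsTrail) :
    (u ∈ S ↔ v ∈ S) ↔ (e ∈ p.edges ↔ e' ∈ p.edges) := by
  induction p with
  | nil => simp
  | @cons a b c h p ih =>
    rw [Walk.isTrail_cons] at hp
    have key := hS s(a, b) h
    have := ih hp.1
    rw [crosses_mk_iff] at key
    rw [Walk.edges_cons, List.mem_cons, List.mem_cons]
    grind

theorem setW_symmDiff [Finite V] (w : Sym2 V → ℕ) (A B : Set (Sym2 V)) :
    (setW w (symmDiff A B) : ℤ) = (setW w A : ℤ) + (setW w B : ℤ) - 2 * (setW w (A ∩ B) : ℤ) := by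
  have h1 : setW w (A ∩ B) + setW w (A \ B) = setW w A :=
    finsum_mem_inter_add_sdiff B (Set.toFinite A)
  have h2 : setW w (B ∩ A) + setW w (B \ A) = setW w B :=
    finsum_mem_inter_add_sdiff A (Set.toFinite B)
  have h3 : setW w (symmDiff A B) = setW w (A \ B) + setW w (B \ A) :=
    finsum_mem_union disjoint_sdiff_sdiff (Set.toFinite _) (Set.toFinite _)
  rw [Set.inter_comm] at h2
  lia

/-- for distinct tree edges `e ≠ e'`, if `S` induces the 2-respecting cut
determined by `(e, e')` (the tree edges crossing `S` are exactly `e` and `e'`), then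
`CutSet(e,e') = CovSet(e) △ CovSet(e')` and
`Cut(e,e') = Cov(e) + Cov(e') - 2·Cov(e,e')`. -/
theorem cutSet_eq_symmDiff_covSets [Fintype V]
    (G T : SimpleGraph V) (hG : G.Connected) (hle : T ≤ G) (hT : T.IsTree) (r : V)
    (w : Sym2 V → ℕ) (hw : ∀ x ∈ G.edgeSet, 1 ≤ w x)
    (e e' : Sym2 V) (he : e ∈ T.edgeSet) (he' : e' ∈ T.edgeSet) (hne : e ≠ e')
    (S : Set V) (hS : {f : Sym2 V | f ∈ T.edgeSet ∧ Crosses S f} = {e, e'}) :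
    {x ∈ G.edgeSet | Crosses S x} = symmDiff (covSet G T e) (covSet G T e') ∧
    (setW w {x ∈ G.edgeSet | Crosses S x} : ℤ) =
      (setW w (covSet G T e) : ℤ) + (setW w (covSet G T e') : ℤ)
        - 2 * (setW w (covSet G T e ∩ covSet G T e') : ℤ) := by
  have hcut : {x ∈ G.edgeSet | Crosses S x} = symmDiff (covSet G T e) (covSet G T e') := by
    have hS' : ∀ f ∈ T.edgeSet, Crosses S f ↔ f = e ∨ f = e' := fun f hf => by
      have := Set.ext_iff.mp hS f
      simpa [hf] using this
    ext x
    induction x with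
    | _ a b =>
      obtain ⟨p, hp⟩ := hT.connected.exists_isPath a b
      have hpar := hp.isTrail.mem_iff_mem_iff hne hS'
      have hce := covers_mk_iff hT.isAcyclic ⟨p, hp⟩ e
      have hce' := covers_mk_iff hT.isAcyclic ⟨p, hp⟩ e'
      simp only [Set.mem_symmDiff, covSet, Set.mem_ofPred_eq, crosses_mk_iff, hce, hce']
      tauto
  exact ⟨hcut, hcut ▸ setW_symmDiff w _ _⟩
end

section
/- Let e, e', e'' be edges of the spanning tree T such that no simple path in T contains all three of e, e', e''. Then CovSet(e, e') ∩ CovSet(e, e'') = ∅; consequently Cov(e) ≥ Cov(e, e') + Cov(e, e''), so it is impossible that both Cov(e, e') > Cov(e)/2 and Cov(e, e'') > Cov(e)/2 (the edge e cannot be interested in both e' and e''). -/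
open SimpleGraph

variable {V : Type}

/-- Disjoint subsets of a finite set of edges have total weight at most that of the set. -/
theorem setW_add_le_of_disjoint [Finite V] (w : Sym2 V → ℕ) {A B C : Set (Sym2 V)}
    (hA : A ⊆ C) (hB : B ⊆ C) (hAB : Disjoint A B) : setW w A + setW w B ≤ setW w C := by
  unfold setW
  rw [← finsum_mem_union hAB (Set.toFinite A) (Set.toFinite B),
    ← finsum_mem_add_sdiff (Set.union_subset hA hB) (Set.toFinite C)]
  exact Nat.le_add_right _ _

/-- if no simple path of `T` contains all of `e, e', e''` then
`CovSet(e,e') ∩ CovSet(e,e'') = ∅`, hence `Cov(e) ≥ Cov(e,e') + Cov(e,e'')`,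
so `e` cannot be interested in both `e'` and `e''`
(where `e` is interested in `f` iff `Cov(e,f) > Cov(e)/2`). -/
theorem covSets_disjoint_of_no_common_path [Fintype V]
    (G T : SimpleGraph V) (hG : G.Connected) (hle : T ≤ G) (hT : T.IsTree) (r : V)
    (w : Sym2 V → ℕ) (hw : ∀ x ∈ G.edgeSet, 1 ≤ w x)
    (e e' e'' : Sym2 V) (he : e ∈ T.edgeSet) (he' : e' ∈ T.edgeSet) (he'' : e'' ∈ T.edgeSet)
    (hpath : ¬ ∃ (a b : V) (p : T.Path a b),
      e ∈ p.1.edges ∧ e' ∈ p.1.edges ∧ e'' ∈ p.1.edges) :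
    (covSet G T e ∩ covSet G T e') ∩ (covSet G T e ∩ covSet G T e'') = ∅ ∧
    setW w (covSet G T e ∩ covSet G T e') + setW w (covSet G T e ∩ covSet G T e'')
      ≤ setW w (covSet G T e) ∧
    ¬ (setW w (covSet G T e) < 2 * setW w (covSet G T e ∩ covSet G T e') ∧
       setW w (covSet G T e) < 2 * setW w (covSet G T e ∩ covSet G T e'')) := by
  have h_disj : (covSet G T e ∩ covSet G T e') ∩ (covSet G T e ∩ covSet G T e'') = ∅ := by
    refine Set.eq_empty_of_forall_notMem fun x hx => hpath ?_
    obtain ⟨⟨⟨-, h⟩, -, h'⟩, -, -, h''⟩ := hx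
    induction x with
    | _ a b =>
      obtain ⟨p, hp⟩ := hT.connected.exists_isPath a b
      exact ⟨a, b, ⟨p, hp⟩, h a b rfl _, h' a b rfl _, h'' a b rfl _⟩
  have h_le := setW_add_le_of_disjoint w (Set.inter_subset_left (t := covSet G T e'))
    (Set.inter_subset_left (t := covSet G T e'')) (Set.disjoint_iff_inter_eq_empty.mpr h_disj)
  exact ⟨h_disj, h_le, by lia⟩
end

section
/- If P and P' are orthogonal ancestor-to-descendant paths in the rooted spanning tree T, then the subtrees T(P) and T(P') are edge-disjoint, and the vertex sets T(P↓) and T(P'↓) are disjoint. -/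
open SimpleGraph

variable {V : Type}

/-- `a` is a (weak) ancestor of `v` in the tree `T` rooted at `r`:
`a` lies on every `T`-path from `v` to `r`. -/
def IsAnc (T : SimpleGraph V) (r a v : V) : Prop :=
  ∀ p : T.Path v r, a ∈ p.1.support

/-- Two tree edges are orthogonal: they do not lie on a common descending path
from the root (equivalently, on a common root-to-leaf path). -/
def OrthE (T : SimpleGraph V) (r : V) (f g : Sym2 V) : Prop :=
  ¬ ∃ (u : V) (q : T.Path r u), f ∈ q.1.edges ∧ g ∈ q.1.edges

/-- Two paths are orthogonal if every edge of one is orthogonal to every edge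
of the other. -/
def pathOrth (T : SimpleGraph V) (r : V) {a b a' b' : V}
    (p : T.Path a b) (p' : T.Path a' b') : Prop :=
  ∀ f ∈ p.1.edges, ∀ g ∈ p'.1.edges, OrthE T r f g

/-- `T(P↓)`: vertices lying in a subtree rooted at a vertex of the
ancestor-to-descendant path `p` other than its top vertex `a`. -/
def downVerts (T : SimpleGraph V) (r : V) {a b : V} (p : T.Path a b) : Set V :=
  {u | ∃ v ∈ p.1.support, v ≠ a ∧ IsAnc T r v u}

theorem IsAnc.trans {T : SimpleGraph V} {r a v u : V} (hav : IsAnc T r a v)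
    (hvu : IsAnc T r v u) : IsAnc T r a u := by
  classical
  intro p
  have hv := hvu p
  exact p.1.support_dropUntil_subset_support hv (hav ⟨p.1.dropUntil v hv, p.2.dropUntil hv⟩)

theorem IsAnc.antisymm {T : SimpleGraph V} (hT : T.IsTree) {r u v : V}
    (huv : IsAnc T r u v) (hvu : IsAnc T r v u) : u = v := by
  classical
  obtain ⟨q, hq⟩ := hT.1.exists_isPath v r
  have hu := huv ⟨q, hq⟩
  have hv := hvu ⟨q.dropUntil u hu, hq.dropUntil hu⟩
  have heq : (q.dropUntil u hu).dropUntil v hv = q :=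
    (hT.existsUnique_path v r).unique ((hq.dropUntil hu).dropUntil hv) hq
  have h₁ := congrArg Walk.length (q.take_spec hu)
  have h₂ := congrArg Walk.length ((q.dropUntil u hu).take_spec hv)
  rw [Walk.length_append] at h₁ h₂
  rw [heq] at h₂
  exact (Walk.eq_of_length_eq_zero (p := q.takeUntil u hu) (by omega)).symm

/-- The path to the root from a vertex `v` of a descending path `p` first climbs along `p` to its
top vertex. -/
theorem exists_eq_append_of_mem_support {T : SimpleGraph V} (hT : T.IsTree) {r a b v : V}
    (p : T.Path a b) (hab : IsAnc T r a b) (hv : v ∈ p.1.support) (s : T.Path v r) :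
    ∃ (w : T.Walk v a) (y : T.Walk a r), s.1 = w.append y ∧ w.edges ⊆ p.1.edges := by
  classical
  obtain ⟨x, hx⟩ := hT.1.exists_isPath b r
  have ha := hab ⟨x, hx⟩
  have hrev : x.takeUntil a ha = p.1.reverse :=
    (hT.existsUnique_path b a).unique (hx.takeUntil ha) p.2.reverse
  have hv' : v ∈ p.1.reverse.support := by simpa using hv
  refine ⟨p.1.reverse.dropUntil v hv', x.dropUntil a ha, ?_, fun e he => ?_⟩
  · refine (hT.existsUnique_path v r).unique s.2 ?_
    have h := hx
    rw [← x.take_spec ha, hrev, ← p.1.reverse.take_spec hv', ← Walk.append_assoc] at h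
    exact h.of_append_right
  · simpa using p.1.reverse.edges_dropUntil_subset_edges hv' he

theorem isAnc_of_mem_support {T : SimpleGraph V} (hT : T.IsTree) {r a b v : V}
    (p : T.Path a b) (hab : IsAnc T r a b) (hv : v ∈ p.1.support) : IsAnc T r a v := by
  intro s
  obtain ⟨w, y, hs, -⟩ := exists_eq_append_of_mem_support hT p hab hv s
  rw [hs, Walk.mem_support_append_iff]
  exact Or.inl w.end_mem_support

/-- The path to the root from a vertex of `T(P↓)` uses an edge of `P`. -/
theorem exists_mem_edges_of_mem_downVerts {T : SimpleGraph V} (hT : T.IsTree) {r a b u : V}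
    (p : T.Path a b) (hab : IsAnc T r a b) (hu : u ∈ downVerts T r p) (q : T.Path u r) :
    ∃ e ∈ p.1.edges, e ∈ q.1.edges := by
  classical
  obtain ⟨v, hv, hva, hvu⟩ := hu
  have hvq := hvu q
  obtain ⟨w, y, hs, hw⟩ := exists_eq_append_of_mem_support hT p hab hv
    ⟨q.1.dropUntil v hvq, q.2.dropUntil hvq⟩
  obtain ⟨e, he⟩ : ∃ e, e ∈ w.edges := by
    cases w with
    | nil => exact absurd rfl hva
    | @cons _ x _ h w => exact ⟨s(v, x), by simp⟩
  refine ⟨e, hw he, q.1.edges_dropUntil_subset_edges hvq ?_⟩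
  change q.1.dropUntil v hvq = _ at hs
  rw [hs, Walk.edges_append]
  exact List.mem_append_left _ he

theorem disjoint_downVerts_of_pathOrth {T : SimpleGraph V} (hT : T.IsTree) {r a b a' b' : V}
    (p : T.Path a b) (p' : T.Path a' b') (hp : IsAnc T r a b) (hp' : IsAnc T r a' b')
    (horth : pathOrth T r p p') : Disjoint (downVerts T r p) (downVerts T r p') := by
  rw [Set.disjoint_left]
  intro u hu hu'
  obtain ⟨q, hq⟩ := hT.1.exists_isPath u r
  obtain ⟨e, he, heq⟩ := exists_mem_edges_of_mem_downVerts hT p hp hu ⟨q, hq⟩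
  obtain ⟨f, hf, hfq⟩ := exists_mem_edges_of_mem_downVerts hT p' hp' hu' ⟨q, hq⟩
  exact horth e he f hf ⟨u, ⟨q.reverse, hq.reverse⟩, by simpa using heq, by simpa using hfq⟩

/-- Two descending paths cannot each hang below the top vertex of the other. -/
theorem notMem_downVerts_of_mem_downVerts {T : SimpleGraph V} (hT : T.IsTree) {r a b a' b' : V}
    (p : T.Path a b) (p' : T.Path a' b') (hp : IsAnc T r a b) (hp' : IsAnc T r a' b')
    (ha' : a' ∈ downVerts T r p) : a ∉ downVerts T r p' := by
  rintro ⟨v', hv', -, hv'a⟩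
  obtain ⟨v, hv, hva, hva'⟩ := ha'
  have hav := isAnc_of_mem_support hT p hp hv
  have hav' := isAnc_of_mem_support hT p' hp' hv'
  exact hva (IsAnc.antisymm hT (hva'.trans (hav'.trans hv'a)) hav)

/-- orthogonal ancestor-to-descendant paths `P`, `P'` have edge-disjoint
subtrees `T(P)`, `T(P')` (whose vertex sets are `{a} ∪ T(P↓)` resp. `{a'} ∪ T(P'↓)`),
and disjoint vertex sets `T(P↓)`, `T(P'↓)`. -/
theorem orthogonal_paths_subtrees_disjoint [Fintype V]
    (T : SimpleGraph V) (hT : T.IsTree) (r : V)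
    {a b a' b' : V} (p : T.Path a b) (p' : T.Path a' b')
    (hp : IsAnc T r a b) (hp' : IsAnc T r a' b')
    (horth : pathOrth T r p p') :
    Disjoint {f | f ∈ T.edgeSet ∧ ∀ v ∈ f, v ∈ insert a (downVerts T r p)}
             {f | f ∈ T.edgeSet ∧ ∀ v ∈ f, v ∈ insert a' (downVerts T r p')} ∧
    Disjoint (downVerts T r p) (downVerts T r p') := by
  have hdisj := disjoint_downVerts_of_pathOrth hT p p' hp hp' horth
  refine ⟨?_, hdisj⟩
  have hd := Set.disjoint_left.1 hdisj
  have hnot := notMem_downVerts_of_mem_downVerts hT p p' hp hp'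
  rw [Set.disjoint_left]
  rintro f ⟨hf, h⟩ ⟨-, h'⟩
  induction f using Sym2.ind with
  | _ x y =>
    have hxy : x ≠ y := T.ne_of_adj hf
    have hx := h x (by simp)
    have hy := h y (by simp)
    have hx' := h' x (by simp)
    have hy' := h' y (by simp)
    rw [Set.mem_insert_iff] at hx hy hx' hy'
    grind
end

section
/- Let F be a subtree of the rooted spanning tree T such that exactly two vertices r_F and d_F of F have T-neighbors outside F, where d_F is a descendant of r_F; call the tree path between r_F and d_F the highway of F. Then every simple path in T whose two endpoints both lie outside the vertex set of F and which contains at least one edge of F contains the entire highway of F. -/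
open SimpleGraph

variable {V : Type}

/-- `v` is a vertex of the subgraph `F` having a `T`-neighbor outside `F`:
some edge of `T` incident to `v` is not an edge of `F` and its other endpoint is
not in `F`. -/
def hasOutNbr (T : SimpleGraph V) (F : T.Subgraph) (v : V) : Prop :=
  v ∈ F.verts ∧ ∃ u, T.Adj v u ∧ ¬ F.Adj v u ∧ u ∉ F.verts

/-- A walk splits around any of its edges. -/
theorem SimpleGraph.Walk.exists_eq_append_cons_of_mem_edges {G : SimpleGraph V} {x y : V}
    (p : G.Walk x y) {e : Sym2 V} (he : e ∈ p.edges) :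
    ∃ (a b : V) (h : G.Adj a b) (p₁ : G.Walk x a) (p₂ : G.Walk b y),
      e = s(a, b) ∧ p = p₁.append (.cons h p₂) := by
  induction p with
  | nil => simp at he
  | cons h p ih =>
    rw [Walk.edges_cons, List.mem_cons] at he
    rcases he with rfl | he
    · exact ⟨_, _, h, .nil, p, rfl, rfl⟩
    · obtain ⟨a, b, h', p₁, p₂, rfl, rfl⟩ := ih he
      exact ⟨a, b, h', .cons h p₁, p₂, rfl, rfl⟩

/-- A walk leaving the vertex set of `F` visits a vertex with a neighbor outside `F`. -/
theorem exists_mem_support_hasOutNbr {T : SimpleGraph V} {F : T.Subgraph} {a y : V}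
    (p : T.Walk a y) (ha : a ∈ F.verts) (hy : y ∉ F.verts) :
    ∃ v ∈ p.support, hasOutNbr T F v := by
  obtain ⟨d, hd, hfst, hsnd⟩ := p.exists_boundary_dart F.verts ha hy
  exact ⟨d.fst, p.dart_fst_mem_support_of_mem_darts hd, hfst, d.snd, d.adj,
    fun h => hsnd h.snd_mem, hsnd⟩

/-- In an acyclic graph every walk uses all edges of the path joining its endpoints. -/
theorem SimpleGraph.IsAcyclic.edges_path_subset {G : SimpleGraph V} (hG : G.IsAcyclic) {u v : V}
    (q : G.Path u v) (w : G.Walk u v) : q.1.edges ⊆ w.edges := by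
  classical
  rw [(hG.subsingleton_path u v).elim q w.toPath]
  exact w.edges_toPath_subset_edges

/-- if the subtree `F` of `T` has exactly two boundary vertices
`r_F`, `d_F` (with `d_F` a descendant of `r_F`), then every simple path of `T`
with both endpoints outside `F` that uses an edge of `F` contains the whole
highway of `F` (the tree path from `r_F` to `d_F`). -/
theorem path_through_fragment_contains_highway [Fintype V]
    (T : SimpleGraph V) (hT : T.IsTree) (r : V)
    (F : T.Subgraph) (hFc : F.Connected)
    (rF dF : V) (hne : rF ≠ dF)
    (hbd : {v | hasOutNbr T F v} = {rF, dF})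
    (hdesc : IsAnc T r rF dF) :
    ∀ (x y : V) (p : T.Path x y), x ∉ F.verts → y ∉ F.verts →
      (∃ f ∈ p.1.edges, f ∈ F.edgeSet) →
      ∀ (q : T.Path rF dF), ∀ f ∈ q.1.edges, f ∈ p.1.edges := by
  classical
  rintro x y ⟨p, hp⟩ hx hy ⟨e, hep, heF⟩ q f hf
  obtain ⟨a, b, h, p₁, p₂, rfl, rfl⟩ := p.exists_eq_append_cons_of_mem_edges hep
  have hab : F.Adj a b := heF
  obtain ⟨u, hu, hub⟩ := exists_mem_support_hasOutNbr p₁.reverse hab.fst_mem hx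
  obtain ⟨v, hv, hvb⟩ := exists_mem_support_hasOutNbr p₂ hab.snd_mem hy
  rw [Walk.support_reverse, List.mem_reverse] at hu
  have huv : u ≠ v := by
    rintro rfl
    have hnd := hp.support_nodup
    rw [Walk.support_append, Walk.support_cons, List.tail_cons] at hnd
    exact List.disjoint_of_nodup_append hnd hu hv
  let w : T.Walk u v := (p₁.dropUntil u hu).append (.cons h (p₂.takeUntil v hv))
  have hw : w.edges ⊆ (p₁.append (.cons h p₂)).edges := by
    intro g hg
    simp only [w, Walk.edges_append, Walk.edges_cons, List.mem_append, List.mem_cons] at hg ⊢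
    exact hg.imp (fun hg => p₁.edges_dropUntil_subset_edges hu hg)
      (Or.imp_right fun hg => p₂.edges_takeUntil_subset_edges hv hg)
  apply hw
  have hu' : u ∈ ({rF, dF} : Set V) := hbd ▸ hub
  have hv' : v ∈ ({rF, dF} : Set V) := hbd ▸ hvb
  rcases hu' with rfl | rfl <;> rcases hv' with rfl | rfl
  · exact absurd rfl huv
  · exact hT.isAcyclic.edges_path_subset q w hf
  · simpa using hT.isAcyclic.edges_path_subset q w.reverse hf
  · exact absurd rfl huv
end

section
/- Let F be a subtree of T such that exactly two vertices r_F and d_F of F have T-neighbors outside F, with d_F a descendant of r_F, and let P be the highway of F (the tree path from r_F to d_F). Let e be an edge of P and let e' be a tree edge not in F. Then every edge x of G that covers both e' and e either has an endpoint in the vertex set of F, or has both endpoints outside F and covers every edge of P. Consequently, Cov(e', e) equals the total weight of edges covering both e' and e with an endpoint in F, plus the total weight of edges covering e' and all of P with both endpoints outside F. -/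
open SimpleGraph

variable {V : Type}

namespace SimpleGraph

/-- A walk through the edge `e` splits at `e`. -/
theorem Walk.exists_eq_append_cons_of_mem_edges_s12 {T : SimpleGraph V} {u v : V} (p : T.Walk u v)
    {e : Sym2 V} (he : e ∈ p.edges) :
    ∃ (s t : V) (h : T.Adj s t) (p₁ : T.Walk u s) (p₂ : T.Walk t v),
      e = s(s, t) ∧ p = p₁.append (Walk.cons h p₂) := by
  induction p with
  | nil => simp at he
  | cons h p ih =>
    rw [Walk.edges_cons, List.mem_cons] at he
    rcases he with rfl | he
    · exact ⟨_, _, h, Walk.nil, p, rfl, rfl⟩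
    · obtain ⟨s, t, h', p₁, p₂, rfl, rfl⟩ := ih he
      exact ⟨s, t, h', Walk.cons h p₁, p₂, rfl, rfl⟩

/-- In an acyclic graph, the path between two vertices of a path is contained in that path. -/
theorem IsAcyclic.edges_subset_of_mem_support {T : SimpleGraph V} (hT : T.IsAcyclic) {u v a b : V}
    {p : T.Walk u v} (hp : p.IsPath) (ha : a ∈ p.support) (hb : b ∈ p.support)
    {q : T.Walk a b} (hq : q.IsPath) : q.edges ⊆ p.edges := by
  classical
  rw [← p.take_spec ha, Walk.mem_support_append_iff] at hb
  rcases hb with hb | hb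
  · have hr : ((p.takeUntil a ha).dropUntil b hb).IsPath := (hp.takeUntil ha).dropUntil hb
    have h : q = ((p.takeUntil a ha).dropUntil b hb).reverse :=
      congrArg Subtype.val ((hT.subsingleton_path a b).elim ⟨q, hq⟩ ⟨_, hr.reverse⟩)
    intro f hf
    rw [h, Walk.edges_reverse, List.mem_reverse] at hf
    exact p.edges_takeUntil_subset_edges ha (Walk.edges_dropUntil_subset_edges _ hb hf)
  · have hr : ((p.dropUntil a ha).takeUntil b hb).IsPath := (hp.dropUntil ha).takeUntil hb
    have h : q = (p.dropUntil a ha).takeUntil b hb :=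
      congrArg Subtype.val ((hT.subsingleton_path a b).elim ⟨q, hq⟩ ⟨_, hr⟩)
    intro f hf
    rw [h] at hf
    exact p.edges_dropUntil_subset_edges ha (Walk.edges_takeUntil_subset_edges _ hb hf)

/-- In an acyclic graph, a connected subgraph contains the path between any two of its vertices. -/
theorem IsAcyclic.edges_subset_edgeSet_of_connected {T : SimpleGraph V} (hT : T.IsAcyclic)
    {F : T.Subgraph} (hF : F.Connected) {a b : V} (ha : a ∈ F.verts) (hb : b ∈ F.verts)
    {q : T.Walk a b} (hq : q.IsPath) {f : Sym2 V} (hf : f ∈ q.edges) : f ∈ F.edgeSet := by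
  obtain ⟨p, hp⟩ := (hF.coe.preconnected ⟨a, ha⟩ ⟨b, hb⟩).exists_isPath
  have hp' : (p.map F.hom).IsPath := hp.map F.hom_injective
  have h : q = p.map F.hom :=
    congrArg Subtype.val ((hT.subsingleton_path a b).elim ⟨q, hq⟩ ⟨_, hp'⟩)
  subst h
  obtain ⟨g, hg, rfl⟩ := List.mem_map.1 (Walk.edges_map F.hom p ▸ hf)
  have hg := p.edges_subset_edgeSet hg
  induction g with
  | h x y => exact hg

end SimpleGraph

/-- A path with both ends outside a connected subgraph `F` that uses an edge inside `F`
visits both of the boundary vertices of `F`. -/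
theorem boundary_mem_support {T : SimpleGraph V} {F : T.Subgraph} {a b : V}
    (hbd : {v | hasOutNbr T F v} = {a, b}) {u u' : V} {p : T.Walk u u'} (hp : p.IsPath)
    (hu : u ∉ F.verts) (hu' : u' ∉ F.verts) {e : Sym2 V} (he : e ∈ p.edges)
    (heF : e ∈ F.edgeSet) : a ∈ p.support ∧ b ∈ p.support := by
  obtain ⟨s, t, hst, p₁, p₂, rfl, rfl⟩ := p.exists_eq_append_cons_of_mem_edges_s12 he
  have hbdry : ∀ {x y : V}, T.Adj x y → x ∈ F.verts → y ∉ F.verts → x = a ∨ x = b := by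
    intro x y hxy hx hy
    have : x ∈ {v | hasOutNbr T F v} := ⟨hx, y, hxy, fun h => hy h.snd_mem, hy⟩
    rwa [hbd] at this
  have hs : s ∈ F.verts := F.edge_vert heF
  have ht : t ∈ F.verts := F.edge_vert (F.adj_symm heF)
  obtain ⟨d₁, hd₁, hx₁, hy₁⟩ := p₁.reverse.exists_boundary_dart F.verts hs hu
  obtain ⟨d₂, hd₂, hx₂, hy₂⟩ := p₂.exists_boundary_dart F.verts ht hu'
  have hm₁ : d₁.fst ∈ p₁.support := by
    simpa using p₁.reverse.dart_fst_mem_support_of_mem_darts hd₁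
  have hm₂ : d₂.fst ∈ p₂.support := p₂.dart_fst_mem_support_of_mem_darts hd₂
  have hne : d₁.fst ≠ d₂.fst := by
    have hnd := hp.support_nodup
    rw [Walk.support_append, Walk.support_cons, List.tail_cons] at hnd
    exact fun h => (List.disjoint_of_nodup_append hnd) hm₁ (h ▸ hm₂)
  have hm₁' : d₁.fst ∈ (p₁.append (Walk.cons hst p₂)).support := by simp [hm₁]
  have hm₂' : d₂.fst ∈ (p₁.append (Walk.cons hst p₂)).support := by simp [hm₂]
  rcases hbdry d₁.adj hx₁ hy₁ with h₁ | h₁ <;> rcases hbdry d₂.adj hx₂ hy₂ with h₂ | h₂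
  · exact absurd (h₁.trans h₂.symm) hne
  · exact ⟨h₁ ▸ hm₁', h₂ ▸ hm₂'⟩
  · exact ⟨h₂ ▸ hm₂', h₁ ▸ hm₁'⟩
  · exact absurd (h₁.trans h₂.symm) hne

/-- let `F` be a subtree with boundary exactly `{r_F, d_F}` and
highway `q` (the tree path from `r_F` to `d_F`), `e` an edge of the highway, and
`e'` a tree edge not in `F`.  Every edge of `G` covering `e'` and `e` either has an
endpoint in `F`, or has both endpoints outside `F` and covers the whole highway;
consequently `Cov(e',e)` splits into the corresponding two weights. -/
theorem cov_split_fragment_highway [Fintype V]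
    (G T : SimpleGraph V) (hG : G.Connected) (hle : T ≤ G) (hT : T.IsTree) (r : V)
    (w : Sym2 V → ℕ) (hw : ∀ x ∈ G.edgeSet, 1 ≤ w x)
    (F : T.Subgraph) (hFc : F.Connected)
    (rF dF : V) (hne : rF ≠ dF)
    (hbd : {v | hasOutNbr T F v} = {rF, dF})
    (hdesc : IsAnc T r rF dF)
    (q : T.Path rF dF) (e : Sym2 V) (he : e ∈ q.1.edges)
    (e' : Sym2 V) (he' : e' ∈ T.edgeSet) (he'F : e' ∉ F.edgeSet) :
    (∀ x ∈ G.edgeSet, Covers T x e' → Covers T x e →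
      (∃ v ∈ x, v ∈ F.verts) ∨
        ((∀ v ∈ x, v ∉ F.verts) ∧ ∀ f ∈ q.1.edges, Covers T x f)) ∧
    setW w {x ∈ G.edgeSet | Covers T x e' ∧ Covers T x e}
      = setW w {x ∈ G.edgeSet | Covers T x e' ∧ Covers T x e ∧ ∃ v ∈ x, v ∈ F.verts}
        + setW w {x ∈ G.edgeSet |
            Covers T x e' ∧ (∀ f ∈ q.1.edges, Covers T x f) ∧ ∀ v ∈ x, v ∉ F.verts} := by
  have hmem : ∀ v ∈ ({rF, dF} : Set V), v ∈ F.verts := fun v hv => by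
    rw [← hbd] at hv
    exact hv.1
  have heF : e ∈ F.edgeSet := hT.isAcyclic.edges_subset_edgeSet_of_connected hFc
    (hmem rF (by simp)) (hmem dF (by simp)) q.2 he
  have hcov : ∀ x ∈ G.edgeSet, Covers T x e' → Covers T x e →
      (∃ v ∈ x, v ∈ F.verts) ∨
        ((∀ v ∈ x, v ∉ F.verts) ∧ ∀ f ∈ q.1.edges, Covers T x f) := by
    intro x _ _ hxe
    by_cases hx : ∃ v ∈ x, v ∈ F.verts
    · exact Or.inl hx
    · push Not at hx
      refine Or.inr ⟨hx, ?_⟩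
      rintro f hf u u' rfl p
      obtain ⟨hr, hd⟩ := boundary_mem_support hbd p.2 (hx u (by simp)) (hx u' (by simp))
        (hxe u u' rfl p) heF
      exact hT.isAcyclic.edges_subset_of_mem_support p.2 hr hd q.2 hf
  refine ⟨hcov, ?_⟩
  have hsplit : {x ∈ G.edgeSet | Covers T x e' ∧ Covers T x e}
      = {x ∈ G.edgeSet | Covers T x e' ∧ Covers T x e ∧ ∃ v ∈ x, v ∈ F.verts}
        ∪ {x ∈ G.edgeSet |
            Covers T x e' ∧ (∀ f ∈ q.1.edges, Covers T x f) ∧ ∀ v ∈ x, v ∉ F.verts} := by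
    ext x
    constructor
    · rintro ⟨hx, hxe', hxe⟩
      exact (hcov x hx hxe' hxe).imp (fun h => ⟨hx, hxe', hxe, h⟩)
        fun h => ⟨hx, hxe', h.2, h.1⟩
    · rintro (⟨hx, hxe', hxe, _⟩ | ⟨hx, hxe', h, _⟩)
      · exact ⟨hx, hxe', hxe⟩
      · exact ⟨hx, hxe', h e he⟩
  unfold setW
  rw [hsplit, finsum_mem_union _ (Set.toFinite _) (Set.toFinite _)]
  rw [Set.disjoint_left]
  rintro x ⟨_, _, _, v, hv, hvF⟩ ⟨_, _, _, h⟩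
  exact h v hv hvF
end

section
/- (Path-partitioning, size bound.) Let P' be an ancestor-to-descendant path in T with L edges and top vertex t, and let P_H be an ancestor-to-descendant path that is either completely orthogonal to P' or lies completely above P' (so t is the endpoint of P' closest to P_H). Let P_H be partitioned into consecutive subpaths P₁, …, P_k, ordered from farthest from the root to closest. For each i, let e_{i,1}, e_{i,2} denote the lowest and highest edges of P_i, and for b ∈ {1, 2} let e'_{i,b} be the edge of P' closest to t among those minimizing Cut(·, e_{i,b}) over the edges of P'; let E'_i be the set of edges of P' lying (inclusively) between e'_{i,1} and e'_{i,2} on P'. Then Σ_{i=1}^k |E'_i| ≤ L + 2k. -/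
open SimpleGraph

variable {V : Type}

/-- The edge `f'` lies (strictly) on the tree path between the edge `f` and the
vertex `t`, i.e. `f'` is closer to `t` than `f`. -/
def EdgeCloser (T : SimpleGraph V) (t : V) (f' f : Sym2 V) : Prop :=
  ∀ x y : V, f = s(x, y) →
    (∀ p : T.Path x t, f' ∈ p.1.edges) ∧ (∀ p : T.Path y t, f' ∈ p.1.edges)

/-- `f` lies (inclusively) between the edges `g` and `h` with respect to
closeness to `t`. -/
def EdgeBetween (T : SimpleGraph V) (t : V) (g h f : Sym2 V) : Prop :=
  f = g ∨ f = h ∨ (EdgeCloser T t f g ∧ EdgeCloser T t h f) ∨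
    (EdgeCloser T t f h ∧ EdgeCloser T t g f)

theorem crosses_mk {S : Set V} {x y : V} :
    Crosses S s(x, y) ↔ (x ∈ S ∧ y ∉ S) ∨ (y ∈ S ∧ x ∉ S) := by
  constructor
  · rintro ⟨a, b, h, ha, hb⟩
    rcases Sym2.eq_iff.1 h with ⟨rfl, rfl⟩ | ⟨rfl, rfl⟩
    · exact Or.inl ⟨ha, hb⟩
    · exact Or.inr ⟨ha, hb⟩
  · rintro (⟨h, h'⟩ | ⟨h, h'⟩)
    · exact ⟨x, y, rfl, h, h'⟩
    · exact ⟨y, x, Sym2.eq_swap, h, h'⟩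

/-- The edge `e` lies on the `T`-path from `o` to `u`. -/
def OnPath (T : SimpleGraph V) (o u : V) (e : Sym2 V) : Prop :=
  ∃ q : T.Path o u, e ∈ q.1.edges

theorem onPath_iff {T : SimpleGraph V} (hT : T.IsTree) {o u : V} {e : Sym2 V} (q : T.Path o u) :
    OnPath T o u e ↔ e ∈ q.1.edges :=
  ⟨fun ⟨q', h⟩ => (hT.isAcyclic.subsingleton_path o u).elim q' q ▸ h, fun h => ⟨q, h⟩⟩

theorem exists_path {T : SimpleGraph V} (hT : T.IsTree) (o u : V) : Nonempty (T.Path o u) := by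
  classical
  obtain ⟨q⟩ := hT.connected.preconnected o u
  exact ⟨q.toPath⟩

/-- The two components obtained by deleting a tree edge separate exactly the pairs of vertices
whose tree path uses that edge. -/
theorem exists_onPath_iff_separates {T : SimpleGraph V} (hT : T.IsTree) (e : Sym2 V) :
    ∃ K : Set V, ∀ x y, OnPath T x y e ↔ ¬ (x ∈ K ↔ y ∈ K) := by
  classical
  induction e using Sym2.ind with
  | _ a b =>
  set T' := T.deleteEdges {s(a, b)} with hT'
  have hnot : ∀ x y, ¬ OnPath T x y s(a, b) → T'.Reachable x y := by
    intro x y h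
    obtain ⟨q⟩ := exists_path hT x y
    rw [onPath_iff hT q] at h
    exact ⟨q.1.toDeleteEdge s(a, b) h⟩
  have hreach : ∀ x y, T'.Reachable x y → ¬ OnPath T x y s(a, b) := by
    rintro x y ⟨q⟩ h
    have hq := (onPath_iff hT ((q.mapLe (deleteEdges_le _)).toPath)).1 h
    have h1 := Walk.edges_toPath_subset_edges _ hq
    rw [Walk.edges_mapLe_eq_edges] at h1
    have h2 := q.edges_subset_edgeSet h1
    simp [hT', edgeSet_deleteEdges] at h2
  have hstep : ∀ u v, T.Walk u v → T'.Reachable a v ∨ T'.Reachable b v →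
      T'.Reachable a u ∨ T'.Reachable b u := by
    intro u v q hv
    induction q with
    | nil => exact hv
    | @cons x y z h q ih =>
      by_cases hxy : s(x, y) = s(a, b)
      · rcases Sym2.eq_iff.1 hxy with ⟨rfl, -⟩ | ⟨rfl, -⟩
        · exact Or.inl (Reachable.refl _)
        · exact Or.inr (Reachable.refl _)
      · have hyx : T'.Reachable y x := by
          refine Adj.reachable ?_
          rw [hT', deleteEdges_adj]
          exact ⟨h.symm, by rwa [Set.mem_singleton_iff, Sym2.eq_swap]⟩
        exact (ih hv).imp (·.trans hyx) (·.trans hyx)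
  have hcl : ∀ u, T'.Reachable a u ∨ T'.Reachable b u := by
    intro u
    obtain ⟨q⟩ := hT.connected.preconnected u a
    exact hstep u a q (Or.inl (Reachable.refl _))
  refine ⟨{u | T'.Reachable a u}, fun x y => ?_⟩
  simp only [Set.mem_ofPred_eq]
  constructor
  · intro h hxy
    refine hreach x y ?_ h
    by_cases hx : T'.Reachable a x
    · exact hx.symm.trans (hxy.1 hx)
    · exact ((hcl x).resolve_left hx).symm.trans ((hcl y).resolve_left (fun hy => hx (hxy.2 hy)))
  · intro h
    by_contra hn
    have := hnot x y hn
    exact h ⟨fun hx => hx.trans this, fun hy => hy.trans this.symm⟩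

theorem onPath_comm_xor {T : SimpleGraph V} (hT : T.IsTree) (e : Sym2 V) (x y z : V) :
    OnPath T y z e ↔ ¬ (OnPath T x y e ↔ OnPath T x z e) := by
  obtain ⟨K, hK⟩ := exists_onPath_iff_separates hT e
  rw [hK, hK, hK]
  tauto

theorem onPath_adj {T : SimpleGraph V} (hT : T.IsTree) {x y : V} (h : T.Adj x y) (e : Sym2 V) :
    OnPath T x y e ↔ e = s(x, y) := by
  rw [onPath_iff hT (Path.singleton h)]
  simp [Path.singleton]

/-- A walk splits at any given occurrence of an edge. -/
theorem exists_eq_append_cons_of_edges_eq {T : SimpleGraph V} {o b : V} (q : T.Walk o b)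
    {l₁ l₂ : List (Sym2 V)} {e : Sym2 V} (h : q.edges = l₁ ++ e :: l₂) :
    ∃ (x y : V) (hxy : T.Adj x y) (q₁ : T.Walk o x) (q₂ : T.Walk y b),
      q = q₁.append (Walk.cons hxy q₂) ∧ q₁.edges = l₁ ∧ e = s(x, y) := by
  induction q generalizing l₁ with
  | nil => simp at h
  | @cons x y z hxy q ih =>
    cases l₁ with
    | nil =>
      simp only [Walk.edges_cons, List.nil_append, List.cons.injEq] at h
      exact ⟨x, y, hxy, Walk.nil, q, rfl, rfl, h.1.symm⟩
    | cons g l₁ =>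
      simp only [Walk.edges_cons, List.cons_append, List.cons.injEq] at h
      obtain ⟨x', y', h', q₁, q₂, rfl, h1, h2⟩ := ih h.2
      exact ⟨x', y', h', Walk.cons hxy q₁, q₂, rfl, by simp [h1, h.1], h2⟩

/-- A tree path from `o` that uses an edge of a path `q` from `o` uses all the earlier edges
of `q`. -/
theorem OnPath.of_edges_eq {T : SimpleGraph V} (hT : T.IsTree) {o b u : V} (q : T.Path o b)
    {l₁ l₂ : List (Sym2 V)} {e g : Sym2 V} (h : q.1.edges = l₁ ++ e :: l₂) (hg : g ∈ l₁)
    (he : OnPath T o u e) : OnPath T o u g := by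
  classical
  obtain ⟨x, y, hxy, q₁, q₂, hq, h1, rfl⟩ := exists_eq_append_cons_of_edges_eq q.1 h
  have hq1 : q₁.IsPath := by
    have := q.2
    rw [hq] at this
    exact this.of_append_left
  obtain ⟨q', hq'⟩ := he
  have hx := q'.1.fst_mem_support_of_mem_edges hq'
  have h2 : OnPath T o x g := ⟨⟨q₁, hq1⟩, h1 ▸ hg⟩
  rw [onPath_iff hT ⟨q'.1.takeUntil x hx, q'.2.takeUntil hx⟩] at h2
  exact ⟨q', q'.1.edges_takeUntil_subset_edges hx h2⟩

theorem OnPath.of_idxOf_le [DecidableEq V] {T : SimpleGraph V} (hT : T.IsTree) {o b u : V}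
    (q : T.Path o b) {e g : Sym2 V} (he : e ∈ q.1.edges)
    (h : q.1.edges.idxOf g ≤ q.1.edges.idxOf e) (heu : OnPath T o u e) : OnPath T o u g := by
  obtain ⟨l₁, l₂, hl, hel⟩ := List.eq_append_cons_of_mem he
  by_cases hg : g ∈ l₁
  · exact heu.of_edges_eq hT q hl hg
  · rw [hl, List.idxOf_append_of_notMem hg, List.idxOf_append_of_notMem hel, List.idxOf_cons_self,
      List.idxOf_cons] at h
    by_cases hge : e = g
    · exact hge ▸ heu
    · rw [beq_false_of_ne hge] at h
      simp at h

theorem EdgeCloser.idxOf_lt [DecidableEq V] {T : SimpleGraph V} {o b : V}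
    (q : T.Path o b) {e g : Sym2 V} (he : e ∈ q.1.edges)
    (h : EdgeCloser T o g e) : q.1.edges.idxOf g < q.1.edges.idxOf e := by
  obtain ⟨l₁, l₂, hl, hel⟩ := List.eq_append_cons_of_mem he
  obtain ⟨x, y, hxy, q₁, q₂, hq, rfl, rfl⟩ := exists_eq_append_cons_of_edges_eq q.1 hl
  have hq1 : q₁.IsPath := by
    have := q.2
    rw [hq] at this
    exact this.of_append_left
  have hg : g ∈ q₁.edges := by
    have := (h x y rfl).1 (Path.reverse ⟨q₁, hq1⟩)
    simpa using this
  rw [hl, List.idxOf_append_of_mem hg, List.idxOf_append_of_notMem hel, List.idxOf_cons_self]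
  simpa using List.idxOf_lt_length_of_mem hg

/-- Concatenating the root path of an ancestor with a descending path gives a path. -/
theorem IsAnc.exists_append {T : SimpleGraph V} (hT : T.IsTree) {r a b : V} (h : IsAnc T r a b)
    (q : T.Path a b) : ∃ (s : T.Path r a) (s' : T.Path r b),
      s'.1.edges = s.1.edges ++ q.1.edges := by
  classical
  obtain ⟨s'⟩ := exists_path hT r b
  have ha : a ∈ s'.1.support := by simpa using h s'.reverse
  refine ⟨⟨s'.1.takeUntil a ha, s'.2.takeUntil ha⟩, s', ?_⟩
  rw [(hT.isAcyclic.subsingleton_path a b).elim q ⟨s'.1.dropUntil a ha, s'.2.dropUntil ha⟩]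
  dsimp only
  rw [← Walk.edges_append, Walk.take_spec]

theorem setW_eq_sum_indicator [Fintype V] [DecidableEq V] (w : Sym2 V → ℕ) (S : Set (Sym2 V)) :
    setW w S = ∑ x, S.indicator w x := by
  rw [setW, finsum_mem_def, finsum_eq_sum_of_fintype]

theorem setW_crosses_uncross [Fintype V] (w : Sym2 V → ℕ) (E : Set (Sym2 V))
    {A A' B B' : Set V} (hA : A' ⊆ A) (hB : B ⊆ B') (hAB : Disjoint A B') :
    setW w {x ∈ E | Crosses (A ∪ B') x} + setW w {x ∈ E | Crosses (A' ∪ B) x} ≤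
      setW w {x ∈ E | Crosses (A ∪ B) x} + setW w {x ∈ E | Crosses (A' ∪ B') x} := by
  classical
  simp only [setW_eq_sum_indicator, ← Finset.sum_add_distrib]
  refine Finset.sum_le_sum fun e _ => ?_
  induction e using Sym2.ind with
  | _ x y =>
  have hx1 := @hA x
  have hx2 := @hB x
  have hx3 : x ∈ A → x ∉ B' := fun h h' => Set.disjoint_left.1 hAB h h'
  have hy1 := @hA y
  have hy2 := @hB y
  have hy3 : y ∈ A → y ∉ B' := fun h h' => Set.disjoint_left.1 hAB h h'
  simp only [Set.indicator_apply, Set.mem_ofPred_eq, crosses_mk, Set.mem_union]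
  by_cases x ∈ A <;> by_cases x ∈ A' <;> by_cases x ∈ B <;> by_cases x ∈ B' <;>
    by_cases y ∈ A <;> by_cases y ∈ A' <;> by_cases y ∈ B <;> by_cases y ∈ B' <;>
    simp_all

theorem sum_sub_add_one_le_of_chain (k : ℕ) (L : ℕ) (a b : Fin k → ℕ) (hba : ∀ i, b i ≤ a i)
    (hab : ∀ (i : ℕ) (h : i + 1 < k), a ⟨i + 1, h⟩ ≤ b ⟨i, Nat.lt_of_succ_lt h⟩)
    (h0 : ∀ h : 0 < k, a ⟨0, h⟩ ≤ L) : ∑ i, (a i - b i + 1) ≤ L + k := by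
  induction k generalizing L with
  | zero => simp
  | succ k ih =>
    rw [Fin.sum_univ_succ]
    have := ih (b 0) (fun i => a i.succ) (fun i => b i.succ) (fun i => hba _)
      (fun i h => hab (i + 1) (by omega)) (fun h => hab 0 (by omega))
    have h1 := h0 (by omega)
    have h2 := hba 0
    change a 0 ≤ L at h1
    omega

theorem setOf_crosses_union_onPath {T : SimpleGraph V} (hT : T.IsTree) {t : V} {e f : Sym2 V}
    (he : e ∈ T.edgeSet) (hf : f ∈ T.edgeSet) (hdis : ∀ u, OnPath T t u f → ¬ OnPath T t u e) :
    {x : Sym2 V | x ∈ T.edgeSet ∧ Crosses ({u | OnPath T t u f} ∪ {u | OnPath T t u e}) x} =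
      {f, e} := by
  have key : ∀ x y, T.Adj x y →
      (Crosses ({u | OnPath T t u f} ∪ {u | OnPath T t u e}) s(x, y) ↔
        s(x, y) = f ∨ s(x, y) = e) := by
    intro x y h
    have h1 := onPath_comm_xor hT f t x y
    have h2 := onPath_comm_xor hT e t x y
    rw [onPath_adj hT h, eq_comm] at h1 h2
    have h3 := hdis x
    have h4 := hdis y
    have h5 : s(x, y) = f → s(x, y) ≠ e := by
      rintro hf rfl
      rw [← hf] at h1 h3 h4
      tauto
    simp only [crosses_mk, Set.mem_union, Set.mem_ofPred_eq]
    tauto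
  ext x
  induction x using Sym2.ind with
  | _ x y =>
  simp only [Set.mem_ofPred_eq, Set.mem_insert_iff, Set.mem_singleton_iff]
  constructor
  · rintro ⟨h, hc⟩
    exact (key x y h).1 hc
  · intro h
    have hxy : s(x, y) ∈ T.edgeSet := by
      rcases h with h | h <;> rw [h] <;> assumption
    exact ⟨hxy, (key x y hxy).2 h⟩

/-- The closest minimizer moves towards the top of the path as the far side of the second edge
grows. -/
theorem idxOf_minimizer_le [Fintype V] [DecidableEq V] {G T : SimpleGraph V} (hT : T.IsTree)
    {w : Sym2 V → ℕ} {cut : Sym2 V → Sym2 V → ℕ}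
    (hcut : ∀ (e e' : Sym2 V) (S : Set V),
      {f : Sym2 V | f ∈ T.edgeSet ∧ Crosses S f} = {e, e'} →
      cut e e' = setW w {x ∈ G.edgeSet | Crosses S x})
    {t b : V} (q : T.Path t b) {e e' m m' : Sym2 V} (he : e ∈ T.edgeSet) (he' : e' ∈ T.edgeSet)
    (hsub : ∀ u, OnPath T t u e → OnPath T t u e')
    (hdis : ∀ f ∈ q.1.edges, ∀ u, OnPath T t u f → ¬ OnPath T t u e')
    (hm : m ∈ q.1.edges) (hmin : ∀ f ∈ q.1.edges, cut m e ≤ cut f e)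
    (hm' : m' ∈ q.1.edges) (hmin' : ∀ f ∈ q.1.edges, cut m' e' ≤ cut f e')
    (hclose : ∀ f ∈ q.1.edges, (∀ g ∈ q.1.edges, cut f e' ≤ cut g e') →
      f = m' ∨ EdgeCloser T t m' f) :
    q.1.edges.idxOf m' ≤ q.1.edges.idxOf m := by
  by_contra! hlt
  have hedge : ∀ f ∈ q.1.edges, f ∈ T.edgeSet := fun f hf => q.1.edges_subset_edgeSet hf
  have hdis' : ∀ f ∈ q.1.edges, ∀ u, OnPath T t u f → ¬ OnPath T t u e :=
    fun f hf u h h' => hdis f hf u h (hsub u h')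
  have huncross := setW_crosses_uncross w G.edgeSet
    (A := {u | OnPath T t u m}) (A' := {u | OnPath T t u m'})
    (B := {u | OnPath T t u e}) (B' := {u | OnPath T t u e'})
    (fun u hu => OnPath.of_idxOf_le hT q hm' hlt.le hu) (fun u hu => hsub u hu)
    (Set.disjoint_left.2 fun u hu hu' => hdis m hm u hu hu')
  rw [← hcut _ _ _ (setOf_crosses_union_onPath hT he' (hedge m hm) (hdis m hm)),
    ← hcut _ _ _ (setOf_crosses_union_onPath hT he (hedge m' hm') (hdis' m' hm')),
    ← hcut _ _ _ (setOf_crosses_union_onPath hT he (hedge m hm) (hdis' m hm)),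
    ← hcut _ _ _ (setOf_crosses_union_onPath hT he' (hedge m' hm') (hdis m' hm'))] at huncross
  have h1 := hmin m' hm'
  rcases hclose m hm (fun g hg => by have := hmin' g hg; omega) with h | h
  · exact hlt.ne (by rw [h])
  · exact hlt.not_gt (h.idxOf_lt q hm)

theorem ncard_edgeBetween_le [DecidableEq V] {T : SimpleGraph V} {t b : V} (q : T.Path t b)
    {g h : Sym2 V} (hg : g ∈ q.1.edges) (hh : h ∈ q.1.edges)
    (hle : q.1.edges.idxOf h ≤ q.1.edges.idxOf g) :
    {f | f ∈ q.1.edges ∧ EdgeBetween T t g h f}.ncard ≤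
      q.1.edges.idxOf g - q.1.edges.idxOf h + 1 := by
  have hcard : (Set.Icc (q.1.edges.idxOf h) (q.1.edges.idxOf g)).ncard =
      q.1.edges.idxOf g - q.1.edges.idxOf h + 1 := by
    rw [← Finset.coe_Icc, Set.ncard_coe_finset, Nat.card_Icc]
    omega
  rw [← hcard]
  refine Set.ncard_le_ncard_of_injOn (fun f => q.1.edges.idxOf f) ?_ ?_ (Set.finite_Icc _ _)
  · rintro f ⟨hf, hb⟩
    rw [Set.mem_Icc]
    rcases hb with rfl | rfl | ⟨h1, h2⟩ | ⟨h1, h2⟩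
    · exact ⟨hle, le_rfl⟩
    · exact ⟨le_rfl, hle⟩
    · exact ⟨(h2.idxOf_lt q hf).le, (h1.idxOf_lt q hg).le⟩
    · have := h1.idxOf_lt q hh
      have := h2.idxOf_lt q hf
      constructor <;> omega
  · rintro f ⟨hf, -⟩ g ⟨-, -⟩ hfg
    exact (List.idxOf_inj hf).1 hfg

theorem edgeBetween_comm {T : SimpleGraph V} {t : V} {g h f : Sym2 V} :
    EdgeBetween T t g h f ↔ EdgeBetween T t h g f := by
  unfold EdgeBetween
  tauto

/-- Path-partitioning, size bound.  With `P'` an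
ancestor-to-descendant path with `L` edges and top vertex `t = a'`, `P_H` (orthogonal
to or completely above `P'`) partitioned into consecutive subpaths `P₁, …, P_k`
(ordered lowest first), `e'_{i,1}/e'_{i,2}` the closest-to-`t` minimizers of
`Cut(·, e_{i,1})`/`Cut(·, e_{i,2})` over the edges of `P'` (for the lowest/highest
edges `e_{i,1}/e_{i,2}` of `P_i`), and `E'_i` the edges of `P'` between them,
`Σᵢ |E'ᵢ| ≤ L + 2k`. -/
theorem path_partitioning_size_bound [Fintype V]
    (G T : SimpleGraph V) (hG : G.Connected) (hle : T ≤ G) (hT : T.IsTree)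
    (w : Sym2 V → ℕ) (hw : ∀ x ∈ G.edgeSet, 1 ≤ w x) (r : V)
    (cut : Sym2 V → Sym2 V → ℕ)
    (hcut : ∀ (e e' : Sym2 V) (S : Set V),
      {f : Sym2 V | f ∈ T.edgeSet ∧ Crosses S f} = {e, e'} →
      cut e e' = setW w {x ∈ G.edgeSet | Crosses S x})
    {a' b' : V} (p' : T.Path a' b') (hd' : IsAnc T r a' b')
    (k : ℕ) (c d : Fin k → V) (p : ∀ i, T.Path (c i) (d i))
    (hdesc : ∀ i, IsAnc T r (c i) (d i))
    (hchain : ∀ (i : ℕ) (h : i + 1 < k),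
      c ⟨i, Nat.lt_of_succ_lt h⟩ = d ⟨i + 1, h⟩)
    (hconfig : (∀ i, ∀ f ∈ (p i).1.edges, ∀ g ∈ p'.1.edges, OrthE T r f g) ∨
               (∀ i, ∀ f ∈ (p i).1.edges, ∀ q : T.Path r a', f ∈ q.1.edges))
    (eLow eHigh : Fin k → Sym2 V)
    (hHigh : ∀ i, ((p i).1.edges).head? = some (eHigh i))
    (hLow : ∀ i, ((p i).1.edges).getLast? = some (eLow i))
    (e1 e2 : Fin k → Sym2 V)
    (h1 : ∀ i, e1 i ∈ p'.1.edges ∧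
      (∀ f ∈ p'.1.edges, cut (e1 i) (eLow i) ≤ cut f (eLow i)) ∧
      ∀ f ∈ p'.1.edges, (∀ g ∈ p'.1.edges, cut f (eLow i) ≤ cut g (eLow i)) →
        f = e1 i ∨ EdgeCloser T a' (e1 i) f)
    (h2 : ∀ i, e2 i ∈ p'.1.edges ∧
      (∀ f ∈ p'.1.edges, cut (e2 i) (eHigh i) ≤ cut f (eHigh i)) ∧
      ∀ f ∈ p'.1.edges, (∀ g ∈ p'.1.edges, cut f (eHigh i) ≤ cut g (eHigh i)) →
        f = e2 i ∨ EdgeCloser T a' (e2 i) f) :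
    ∑ i : Fin k, {f | f ∈ p'.1.edges ∧ EdgeBetween T a' (e1 i) (e2 i) f}.ncard
      ≤ p'.1.length + 2 * k := by
  classical
  rcases Nat.eq_zero_or_pos k with rfl | hk
  · simp
  have hmemH : ∀ i, eHigh i ∈ (p i).1.edges := fun i => List.mem_of_head? (hHigh i)
  have hmemL : ∀ i, eLow i ∈ (p i).1.edges := fun i => List.mem_of_getLast? (hLow i)
  have hedge : ∀ i, ∀ e ∈ (p i).1.edges, e ∈ T.edgeSet :=
    fun i e he => (p i).1.edges_subset_edgeSet he
  have htop : ∀ f ∈ p'.1.edges, ¬ OnPath T r a' f := by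
    intro f hf ho
    obtain ⟨s, s', hs⟩ := hd'.exists_append hT p'
    rw [onPath_iff hT s] at ho
    have := s'.2.isTrail.edges_nodup
    rw [hs] at this
    exact (List.nodup_append.1 this).2.2 f ho f hf rfl
  have hup : ∀ i u, OnPath T r u (eLow i) → OnPath T r u (eHigh i) := by
    intro i u h
    obtain ⟨s, s', hs⟩ := (hdesc i).exists_append hT (p i)
    obtain ⟨l, hl⟩ := List.head?_eq_some_iff.1 (hHigh i)
    have hm := hmemL i
    rw [hl, List.mem_cons] at hm
    rcases hm with hm | hm
    · exact hm ▸ h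
    · obtain ⟨l₁, l₂, rfl⟩ := List.append_of_mem hm
      refine h.of_edges_eq hT s' (l₁ := s.1.edges ++ eHigh i :: l₁) (l₂ := l₂) ?_ (by simp)
      rw [hs, hl]
      simp
  have hbot : ∀ i, OnPath T r (d i) (eLow i) := by
    intro i
    obtain ⟨s, s', hs⟩ := (hdesc i).exists_append hT (p i)
    exact ⟨s', by rw [hs]; exact List.mem_append_right _ (hmemL i)⟩
  have hup' : ∀ (i : ℕ) (h : i + 1 < k) (u : V),
      OnPath T r u (eHigh ⟨i, Nat.lt_of_succ_lt h⟩) → OnPath T r u (eLow ⟨i + 1, h⟩) := by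
    intro i h u ho
    obtain ⟨s, s', hs⟩ := (hdesc ⟨i, Nat.lt_of_succ_lt h⟩).exists_append hT (p _)
    obtain ⟨l, hl⟩ := List.head?_eq_some_iff.1 (hHigh ⟨i, Nat.lt_of_succ_lt h⟩)
    have hb := hbot ⟨i + 1, h⟩
    rw [← hchain i h, onPath_iff hT s] at hb
    exact ho.of_edges_eq hT s' (by rw [hs, hl]) hb
  have hlen : ∀ e ∈ p'.1.edges, p'.1.edges.idxOf e + 1 ≤ p'.1.length := by
    intro e he
    rw [← Walk.length_edges]
    exact List.idxOf_lt_length_of_mem he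
  rcases hconfig with horth | habove
  · have hne : ∀ i, ∀ e ∈ (p i).1.edges, ¬ OnPath T r a' e := by
      intro i e he ho
      obtain ⟨s, s', hs⟩ := hd'.exists_append hT p'
      rw [onPath_iff hT s] at ho
      refine horth i e he _ (h1 i).1 ⟨b', s', ?_, ?_⟩ <;> rw [hs, List.mem_append]
      · exact Or.inl ho
      · exact Or.inr (h1 i).1
    have hiff : ∀ i, ∀ e ∈ (p i).1.edges, ∀ u, OnPath T a' u e ↔ OnPath T r u e := by
      intro i e he u
      have := hne i e he
      have := onPath_comm_xor hT e r a' u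
      tauto
    have hdis : ∀ i, ∀ e ∈ (p i).1.edges, ∀ f ∈ p'.1.edges, ∀ u,
        OnPath T a' u f → ¬ OnPath T a' u e := by
      intro i e he f hf u hfu heu
      have h3 : OnPath T r u f := by
        have := htop f hf
        have := onPath_comm_xor hT f r a' u
        tauto
      obtain ⟨s, hs⟩ := h3
      exact horth i e he f hf ⟨u, s, (onPath_iff hT s).1 ((hiff i e he u).1 heu), hs⟩
    have hle12 : ∀ i, p'.1.edges.idxOf (e2 i) ≤ p'.1.edges.idxOf (e1 i) := fun i =>
      idxOf_minimizer_le hT hcut p' (hedge i _ (hmemL i)) (hedge i _ (hmemH i))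
        (fun u hu => (hiff i _ (hmemH i) u).2 (hup i u ((hiff i _ (hmemL i) u).1 hu)))
        (hdis i _ (hmemH i)) (h1 i).1 (h1 i).2.1 (h2 i).1 (h2 i).2.1 (h2 i).2.2
    have hle21 : ∀ (i : ℕ) (h : i + 1 < k), p'.1.edges.idxOf (e1 ⟨i + 1, h⟩) ≤
        p'.1.edges.idxOf (e2 ⟨i, Nat.lt_of_succ_lt h⟩) := fun i h =>
      idxOf_minimizer_le hT hcut p' (hedge _ _ (hmemH _)) (hedge _ _ (hmemL _))
        (fun u hu => (hiff _ _ (hmemL _) u).2 (hup' i h u ((hiff _ _ (hmemH _) u).1 hu)))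
        (hdis _ _ (hmemL _)) (h2 _).1 (h2 _).2.1 (h1 _).1 (h1 _).2.1 (h1 _).2.2
    calc _ ≤ ∑ i, (p'.1.edges.idxOf (e1 i) - p'.1.edges.idxOf (e2 i) + 1) :=
          Finset.sum_le_sum fun i _ => ncard_edgeBetween_le p' (h1 i).1 (h2 i).1 (hle12 i)
      _ ≤ p'.1.length + k := sum_sub_add_one_le_of_chain k _ _ _ hle12 hle21
          fun h => by have := hlen _ (h1 ⟨0, h⟩).1; omega
      _ ≤ _ := by omega
  · have hon : ∀ i, ∀ e ∈ (p i).1.edges, OnPath T r a' e := by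
      intro i e he
      obtain ⟨q⟩ := exists_path hT r a'
      exact ⟨q, habove i e he q⟩
    have hiff : ∀ i, ∀ e ∈ (p i).1.edges, ∀ u, OnPath T a' u e ↔ ¬ OnPath T r u e := by
      intro i e he u
      have := hon i e he
      have := onPath_comm_xor hT e r a' u
      tauto
    have hdis : ∀ i, ∀ e ∈ (p i).1.edges, ∀ f ∈ p'.1.edges, ∀ u,
        OnPath T a' u f → ¬ OnPath T a' u e := by
      intro i e he f hf u hfu heu
      have h3 : OnPath T r u f := by
        have := htop f hf
        have := onPath_comm_xor hT f r a' u
        tauto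
      obtain ⟨s, s', hs⟩ := hd'.exists_append hT p'
      obtain ⟨l₁, l₂, hl⟩ := List.append_of_mem hf
      refine (hiff i e he u).1 heu (h3.of_edges_eq hT s' (l₁ := s.1.edges ++ l₁) (l₂ := l₂) ?_ ?_)
      · rw [hs, hl, List.append_assoc]
      · exact List.mem_append_left _ (habove i e he s)
    have hle12 : ∀ i, p'.1.edges.idxOf (e1 i) ≤ p'.1.edges.idxOf (e2 i) := fun i =>
      idxOf_minimizer_le hT hcut p' (hedge i _ (hmemH i)) (hedge i _ (hmemL i))
        (fun u hu => (hiff i _ (hmemL i) u).2 fun h => (hiff i _ (hmemH i) u).1 hu (hup i u h))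
        (hdis i _ (hmemL i)) (h2 i).1 (h2 i).2.1 (h1 i).1 (h1 i).2.1 (h1 i).2.2
    have hle21 : ∀ (i : ℕ) (h : i + 1 < k), p'.1.edges.idxOf (e2 ⟨i, Nat.lt_of_succ_lt h⟩) ≤
        p'.1.edges.idxOf (e1 ⟨i + 1, h⟩) := fun i h =>
      idxOf_minimizer_le hT hcut p' (hedge _ _ (hmemL _)) (hedge _ _ (hmemH _))
        (fun u hu => (hiff _ _ (hmemH _) u).2
          fun h' => (hiff _ _ (hmemL _) u).1 hu (hup' i h u h'))
        (hdis _ _ (hmemH _)) (h1 _).1 (h1 _).2.1 (h2 _).1 (h2 _).2.1 (h2 _).2.2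
    calc _ ≤ ∑ i, ((p'.1.length - p'.1.edges.idxOf (e1 i)) -
            (p'.1.length - p'.1.edges.idxOf (e2 i)) + 1) := by
          refine Finset.sum_le_sum fun i _ => ?_
          simp only [edgeBetween_comm (g := e1 i)]
          have := ncard_edgeBetween_le p' (h2 i).1 (h1 i).1 (hle12 i)
          have := hlen _ (h2 i).1
          have := hlen _ (h1 i).1
          omega
      _ ≤ p'.1.length + k := sum_sub_add_one_le_of_chain k _ _ _
          (fun i => Nat.sub_le_sub_left (hle12 i) _)
          (fun i h => Nat.sub_le_sub_left (hle21 i h) _) (fun h => Nat.sub_le _ _)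
      _ ≤ _ := by omega
end

section
/- Let P and P' be orthogonal ancestor-to-descendant paths in T and let e' be an edge of P'. If some edge x of G covers both e' and every edge of P (i.e., CovSet(e', P) ≠ ∅), then x has one endpoint in T(P'↓) and one endpoint in T(P↓); in particular, there is an edge of G with one endpoint in T(P'↓) and one endpoint in T(P↓). -/
open SimpleGraph

variable {V : Type}

theorem isAnc_of_mem_support_s17 {T : SimpleGraph V} (hT : T.IsAcyclic) {r v w : V}
    (q : T.Path r v) (hw : w ∈ q.1.support) : IsAnc T r w v := by
  intro q'
  rw [(hT.subsingleton_path v r).elim q' q.reverse]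
  simpa using hw

/-- If an edge of the path `p` lies on the path from the root to `v`, then `v` is in `T(p↓)`. -/
theorem mem_downVerts_of_mem_edges {T : SimpleGraph V} (hT : T.IsAcyclic) {r a b v : V}
    (p : T.Path a b) (q : T.Path r v) {f : Sym2 V} (hfp : f ∈ p.1.edges) (hfq : f ∈ q.1.edges) :
    v ∈ downVerts T r p := by
  induction f using Sym2.ind with
  | _ c d =>
    have hcd : c ≠ d := (p.1.adj_of_mem_edges hfp).ne
    by_cases hc : c = a
    · exact ⟨d, p.1.snd_mem_support_of_mem_edges hfp, fun hd => hcd (hc.trans hd.symm),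
        isAnc_of_mem_support_s17 hT q (q.1.snd_mem_support_of_mem_edges hfq)⟩
    · exact ⟨c, p.1.fst_mem_support_of_mem_edges hfp, hc,
        isAnc_of_mem_support_s17 hT q (q.1.fst_mem_support_of_mem_edges hfq)⟩

/-- An edge covered by `s(u, v)` lies on one of the paths from the root to `u` and `v`. -/
theorem Covers.mem_edges_or {T : SimpleGraph V} {r u v : V} {f : Sym2 V}
    (h : Covers T s(u, v) f) (qu : T.Path r u) (qv : T.Path r v) :
    f ∈ qu.1.edges ∨ f ∈ qv.1.edges := by
  classical
  have hf := Walk.edges_bypass_subset_edges _ (h u v rfl (qu.1.reverse.append qv.1).toPath)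
  simpa using hf

/-- for orthogonal ancestor-to-descendant paths `P`, `P'` and an edge
`e'` of `P'`, any edge `x` of `G` covering `e'` and every edge of `P` has one
endpoint in `T(P'↓)` and one endpoint in `T(P↓)`; in particular there is an edge of
`G` between `T(P'↓)` and `T(P↓)`. -/
theorem edge_between_interested_paths [Fintype V]
    (G T : SimpleGraph V) (hG : G.Connected) (hle : T ≤ G) (hT : T.IsTree) (r : V)
    {a b a' b' : V} (p : T.Path a b) (p' : T.Path a' b')
    (hd : IsAnc T r a b) (hd' : IsAnc T r a' b')
    (hne : 0 < p.1.length)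
    (horth : ∀ f ∈ p.1.edges, ∀ g ∈ p'.1.edges, OrthE T r f g)
    (e' : Sym2 V) (he' : e' ∈ p'.1.edges)
    (x : Sym2 V) (hx : x ∈ G.edgeSet) (hcov : Covers T x e')
    (hcovP : ∀ f ∈ p.1.edges, Covers T x f) :
    (∃ u v : V, x = s(u, v) ∧ u ∈ downVerts T r p' ∧ v ∈ downVerts T r p) ∧
    ∃ y ∈ G.edgeSet, ∃ u v : V,
      y = s(u, v) ∧ u ∈ downVerts T r p' ∧ v ∈ downVerts T r p := by
  suffices h : ∃ u v : V, x = s(u, v) ∧ u ∈ downVerts T r p' ∧ v ∈ downVerts T r p from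
    ⟨h, x, hx, h⟩
  classical
  have root_path (w : V) : Nonempty (T.Path r w) :=
    (hT.connected.preconnected r w).elim fun q => ⟨q.toPath⟩
  obtain ⟨f, hf⟩ : ∃ f, f ∈ p.1.edges :=
    List.exists_mem_of_length_pos (by rwa [Walk.length_edges])
  have aux {u v : V} (hxuv : x = s(u, v)) (qu : T.Path r u) (qv : T.Path r v)
      (he : e' ∈ qu.1.edges) :
      ∃ u v : V, x = s(u, v) ∧ u ∈ downVerts T r p' ∧ v ∈ downVerts T r p := by
    have hfv : f ∈ qv.1.edges :=
      (Covers.mem_edges_or (hxuv ▸ hcovP f hf) qu qv).resolve_left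
        fun hfu => horth f hf e' he' ⟨u, qu, hfu, he⟩
    exact ⟨u, v, hxuv, mem_downVerts_of_mem_edges hT.isAcyclic p' qu he' he,
      mem_downVerts_of_mem_edges hT.isAcyclic p qv hf hfv⟩
  obtain ⟨u, v, hxuv⟩ : ∃ u v : V, x = s(u, v) :=
    Sym2.ind (fun u v => ⟨u, v, rfl⟩) x
  obtain ⟨qu⟩ := root_path u
  obtain ⟨qv⟩ := root_path v
  rcases Covers.mem_edges_or (hxuv ▸ hcov) qu qv with he | he
  · exact aux hxuv qu qv he
  · exact aux (hxuv.trans Sym2.eq_swap) qv qu he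
end
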